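/- arXiv:1703.00144 — 3 statements merged into one kernel-verified Lean document; each statement's English description precedes it below -/
import Mathlib

section
/- Let A, B, M be n×n matrices over a field (or over ℝ), let q be a positive integer and a a scalar such that A^q = a·I and the matrix I − a·B^q is invertible. Then M = [∑_{k=0}^{q−1} A^k (M − A M B) B^k] · (I − a·B^q)^{−1}. (Decompression formula for the Stein displacement of M with an a-potent operator A.) -/
/-- The Stein displacements `M - A * M * B`, weighted by powers of `A` and `B`, telescope. -/
theorem sum_pow_mul_stein_mul_pow {R : Type*} [Ring R] (A B M : R) (q : ℕ) :
    ∑ k ∈ Finset.range q, A ^ k * (M - A * M * B) * B ^ k = M - A ^ q * M * B ^ q := by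
  have h (k : ℕ) : A ^ k * (M - A * M * B) * B ^ k =
      A ^ k * M * B ^ k - A ^ (k + 1) * M * B ^ (k + 1) := by
    rw [pow_succ A, pow_succ' B]
    noncomm_ring
  simp_rw [h]
  rw [Finset.sum_range_sub']
  simp

/-- **Decompression formula for the Stein displacement.**
If `A ^ q = a • 1` (i.e. `A` is `a`-potent) and `1 - a • B ^ q` is invertible, then any
matrix `M` is recovered from its Stein displacement `Δ_{A,B}(M) = M - A * M * B` via
`M = (∑_{k=0}^{q-1} A^k (M - A M B) B^k) (1 - a • B^q)⁻¹`. -/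
theorem stein_decompression {K : Type*} [Field K] (n q : ℕ) (hq : 0 < q)
    (A B M : Matrix (Fin n) (Fin n) K) (a : K)
    (hA : A ^ q = a • (1 : Matrix (Fin n) (Fin n) K))
    (hinv : IsUnit (1 - a • B ^ q)) :
    M = (∑ k ∈ Finset.range q, A ^ k * (M - A * M * B) * B ^ k) * (1 - a • B ^ q)⁻¹ := by
  have h : M - A ^ q * M * B ^ q = M * (1 - a • B ^ q) := by
    rw [hA, mul_sub, mul_one, smul_mul_assoc, one_mul, smul_mul_assoc, mul_smul_comm]
  rw [sum_pow_mul_stein_mul_pow, h,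
    Matrix.mul_nonsing_inv_cancel_right _ _ ((Matrix.isUnit_iff_isUnit_det _).mp hinv)]
end

section
/- Let A, B be n×n complex matrices with A = Q^{−1} Λ Q, Λ = diag(λ_1,…,λ_n), let q ≥ 1 and a be a scalar with I − a·B^q invertible, let h ∈ ℂ^n and j an index such that the matrix D_j := ∑_{k=0}^{q−1} (hᵀ B^k (I − a·B^q)^{−1} e_j) Λ^k is invertible. Then for any v ∈ ℂ^n, setting g := Q^{−1} D_j^{−1} Q v, the matrix M := [∑_{k=0}^{q−1} A^k g hᵀ B^k](I − a·B^q)^{−1} has its j-th column equal to v. -/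
open Matrix

theorem Matrix.inv_mul_mul_self_pow {ι R : Type*} [Fintype ι] [DecidableEq ι] [CommRing R]
    {Q : Matrix ι ι R} (hQ : IsUnit Q.det) (X : Matrix ι ι R) (k : ℕ) :
    (Q⁻¹ * X * Q) ^ k = Q⁻¹ * X ^ k * Q := by
  induction k with
  | zero => simp [nonsing_inv_mul Q hQ]
  | succ k ih =>
    rw [pow_succ, ih, pow_succ]
    simp only [Matrix.mul_assoc, mul_nonsing_inv_cancel_left _ _ hQ]

theorem Matrix.col_sum_mul_vecMulVec_mul {ι κ R : Type*} [Fintype ι] [CommRing R]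
    (s : Finset κ) (X Y : κ → Matrix ι ι R) (C : Matrix ι ι R) (g h : ι → R) (i j : ι) :
    ((∑ k ∈ s, X k * vecMulVec g h * Y k) * C) i j =
      ((∑ k ∈ s, vecMul h (Y k * C) j • X k) *ᵥ g) i := by
  simp only [Finset.sum_mul, vecMulVec_mul, mul_vecMulVec, vecMul_vecMul, Matrix.sum_apply,
    vecMulVec_apply, sum_mulVec, Finset.sum_apply, smul_mulVec, Pi.smul_apply, smul_eq_mul]
  exact Finset.sum_congr rfl fun k _ => mul_comm _ _

/-- **Explicit construction of a prescribed column.**  With `A = Q⁻¹ Λ Q`, if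
`D_j := ∑_{k<q} (hᵀ B^k (I - a B^q)⁻¹ e_j) Λ^k` is invertible, then for any `v`,
taking `g := Q⁻¹ D_j⁻¹ Q v`, the matrix `M := (∑_{k<q} A^k g hᵀ B^k)(I - a B^q)⁻¹`
has `j`-th column equal to `v`. -/
theorem ldr_column_construction (n q : ℕ) (hq : 0 < q)
    (A B Q : Matrix (Fin n) (Fin n) ℂ) (lam : Fin n → ℂ) (a : ℂ)
    (hQ : IsUnit Q.det)
    (hA : A = Q⁻¹ * Matrix.diagonal lam * Q)
    (hinv : IsUnit (1 - a • B ^ q))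
    (h : Fin n → ℂ) (j : Fin n)
    (D : Matrix (Fin n) (Fin n) ℂ)
    (hD : D = ∑ k ∈ Finset.range q,
        (vecMul h (B ^ k * (1 - a • B ^ q)⁻¹) j) • (Matrix.diagonal lam) ^ k)
    (hDinv : IsUnit D.det)
    (v : Fin n → ℂ) (g : Fin n → ℂ)
    (hg : g = (Q⁻¹ * D⁻¹ * Q) *ᵥ v)
    (M : Matrix (Fin n) (Fin n) ℂ)
    (hM : M = (∑ k ∈ Finset.range q, A ^ k * vecMulVec g h * B ^ k) * (1 - a • B ^ q)⁻¹) :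
    ∀ i, M i j = v i := by
  intro i
  have hconj : ∑ k ∈ Finset.range q, vecMul h (B ^ k * (1 - a • B ^ q)⁻¹) j • A ^ k =
      Q⁻¹ * D * Q := by
    simp only [hA, inv_mul_mul_self_pow hQ, hD, Finset.mul_sum, Finset.sum_mul,
      Matrix.mul_smul, Matrix.smul_mul]
  have hcancel : Q⁻¹ * D * Q * (Q⁻¹ * D⁻¹ * Q) = 1 := by
    simp only [Matrix.mul_assoc, mul_nonsing_inv_cancel_left _ _ hQ,
      mul_nonsing_inv_cancel_left _ _ hDinv, nonsing_inv_mul _ hQ]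
  rw [hM, col_sum_mul_vecMulVec_mul, hconj, hg, mulVec_mulVec, hcancel, one_mulVec]
end

section
/- Any bounded, measurable sigmoidal function is discriminatory. That is, let σ: ℝ → ℝ be bounded and measurable with σ(t) → 1 as t → +∞ and σ(t) → 0 as t → −∞. If μ is a finite signed Borel measure on the cube [0,1]^n such that ∫_{[0,1]^n} σ(wᵀx + θ) dμ(x) = 0 for every w ∈ ℝ^n and every θ ∈ ℝ, then μ is the zero measure. -/
open Matrix MeasureTheory Filter

/-- Integral of a real function against a finite signed measure, restricted to a set,
defined through the Jordan decomposition `μ = μ⁺ - μ⁻`. -/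
noncomputable def signedIntegral {α : Type*} [MeasurableSpace α]
    (μ : MeasureTheory.SignedMeasure α) (s : Set α) (f : α → ℝ) : ℝ :=
  (∫ x in s, f x ∂μ.toJordanDecomposition.posPart) -
    (∫ x in s, f x ∂μ.toJordanDecomposition.negPart)

/-- Along the affine rescalings `y ↦ m ^ 2 * y + m`, a sigmoidal function converges pointwise
to the indicator of `[0, ∞)`. -/
lemma tendsto_sigmoidal_rescale {σ : ℝ → ℝ} (htop : Tendsto σ atTop (nhds 1))
    (hbot : Tendsto σ atBot (nhds 0)) (y : ℝ) :
    Tendsto (fun m : ℕ => σ ((m : ℝ) ^ 2 * y + m)) atTop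
      (nhds ((Set.Ici (0 : ℝ)).indicator 1 y)) := by
  have hcast : Tendsto (fun m : ℕ => (m : ℝ)) atTop atTop := tendsto_natCast_atTop_atTop
  by_cases hy : 0 ≤ y
  · rw [Set.indicator_of_mem (Set.mem_Ici.mpr hy)]
    refine htop.comp (tendsto_atTop_mono (fun m => ?_) hcast)
    nlinarith [mul_nonneg (sq_nonneg (m : ℝ)) hy]
  · rw [Set.indicator_of_notMem (by simpa using hy)]
    have hlin : Tendsto (fun m : ℕ => (m : ℝ) * y + 1) atTop atBot :=
      tendsto_atBot_add_const_right _ _ (hcast.atTop_mul_const_of_neg (not_le.mp hy))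
    refine hbot.comp ((hcast.atTop_mul_atBot₀ hlin).congr fun m => ?_)
    ring

/-- Integrals of the affine rescalings of a bounded measurable sigmoidal function determine a
finite measure on the real line. -/
lemma measure_ext_of_integral_sigmoidal {σ : ℝ → ℝ} (hmeas : Measurable σ)
    (hbdd : ∃ C : ℝ, ∀ t : ℝ, |σ t| ≤ C) (htop : Tendsto σ atTop (nhds 1))
    (hbot : Tendsto σ atBot (nhds 0)) {P Q : Measure ℝ} [IsFiniteMeasure P] [IsFiniteMeasure Q]
    (h : ∀ a b : ℝ, ∫ t, σ (a * t + b) ∂P = ∫ t, σ (a * t + b) ∂Q) : P = Q := by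
  obtain ⟨C, hC⟩ := hbdd
  refine Measure.ext_of_Ici P Q fun c => ?_
  have key (ν : Measure ℝ) [IsFiniteMeasure ν] :
      Tendsto (fun m : ℕ => ∫ t, σ ((m : ℝ) ^ 2 * t + ((m : ℝ) ^ 2 * -c + m)) ∂ν) atTop
        (nhds (ν.real (Set.Ici c))) := by
    rw [← integral_indicator_one measurableSet_Ici]
    refine tendsto_integral_of_dominated_convergence (fun _ => C)
      (fun m => (hmeas.comp (by fun_prop)).aestronglyMeasurable) (integrable_const C)
      (fun m => ae_of_all _ fun t => hC _) (ae_of_all _ fun t => ?_)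
    have hshift : (Set.Ici c).indicator (1 : ℝ → ℝ) t
        = (Set.Ici (0 : ℝ)).indicator 1 (t - c) := by
      simp [Set.indicator_apply]
    rw [hshift]
    refine (tendsto_sigmoidal_rescale htop hbot (t - c)).congr fun m => ?_
    congr 1
    ring
  have hreal : P.real (Set.Ici c) = Q.real (Set.Ici c) :=
    tendsto_nhds_unique (key P) ((key Q).congr fun m => (h _ _).symm)
  exact (measureReal_eq_measureReal_iff).mp hreal

/-- Two finite measures on a Banach space are equal if all their images under continuous linear
functionals are equal. -/
lemma measure_ext_of_map_strongDual {E : Type*} [NormedAddCommGroup E] [NormedSpace ℝ E]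
    [MeasurableSpace E] [BorelSpace E] [SecondCountableTopology E] [CompleteSpace E]
    {P Q : Measure E} [IsFiniteMeasure P] [IsFiniteMeasure Q]
    (h : ∀ L : StrongDual ℝ E, P.map L = Q.map L) : P = Q := by
  refine Measure.ext_of_charFunDual (funext fun L => ?_)
  rw [charFunDual_eq_charFun_map_one, charFunDual_eq_charFun_map_one, h L]

/-- **Any bounded measurable sigmoidal function is discriminatory** (Cybenko).
If `σ : ℝ → ℝ` is bounded, measurable, with `σ(t) → 1` as `t → +∞` and `σ(t) → 0` as
`t → −∞`, and `μ` is a finite signed Borel measure on the cube `[0,1]^n` such that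
`∫_{[0,1]^n} σ(wᵀx + θ) dμ(x) = 0` for all `w ∈ ℝⁿ`, `θ ∈ ℝ`, then `μ` is the zero measure
on the cube. -/
theorem sigmoidal_is_discriminatory (n : ℕ) (σ : ℝ → ℝ)
    (hmeas : Measurable σ)
    (hbdd : ∃ Cb : ℝ, ∀ t : ℝ, |σ t| ≤ Cb)
    (htop : Tendsto σ atTop (nhds 1))
    (hbot : Tendsto σ atBot (nhds 0))
    (μ : MeasureTheory.SignedMeasure (Fin n → ℝ))
    (hzero : ∀ (w : Fin n → ℝ) (θ : ℝ),
      signedIntegral μ (Set.Icc 0 1) (fun x => σ (w ⬝ᵥ x + θ)) = 0) :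
    μ.restrict (Set.Icc 0 1) = 0 := by
  have hK : MeasurableSet (Set.Icc (0 : Fin n → ℝ) 1) := measurableSet_Icc
  have heq : μ.toJordanDecomposition.posPart.restrict (Set.Icc 0 1)
      = μ.toJordanDecomposition.negPart.restrict (Set.Icc 0 1) := by
    refine measure_ext_of_map_strongDual fun L => ?_
    have hL : Measurable L := L.continuous.measurable
    refine measure_ext_of_integral_sigmoidal hmeas hbdd htop hbot fun a b => ?_
    have hσ : Measurable fun t => σ (a * t + b) := hmeas.comp (by fun_prop)
    rw [integral_map hL.aemeasurable hσ.aestronglyMeasurable,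
      integral_map hL.aemeasurable hσ.aestronglyMeasurable]
    have hdot (x : Fin n → ℝ) : a * L x = (fun i => a * L (Pi.single i 1)) ⬝ᵥ x := by
      simp only [dotProduct, mul_assoc, ← Finset.mul_sum]
      congr 1
      conv_lhs => rw [← Finset.univ_sum_single x, map_sum]
      refine Finset.sum_congr rfl fun i _ => ?_
      rw [mul_comm, ← smul_eq_mul, ← map_smul, ← Pi.single_smul, smul_eq_mul, mul_one]
    have hcomp : (fun x => σ (a * L x + b))
        = fun x => σ ((fun i => a * L (Pi.single i 1)) ⬝ᵥ x + b) :=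
      funext fun x => by rw [hdot x]
    rw [hcomp]
    exact sub_eq_zero.mp (hzero _ b)
  ext i hi
  rw [VectorMeasure.restrict_apply _ hK hi,
    μ.apply_eq_posPart_real_sub_negPart_real (hi.inter hK),
    ← measureReal_restrict_apply hi, ← measureReal_restrict_apply hi, heq, sub_self]
  rfl
end
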